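/- Let p > 3 be a prime, q = p^r, and let a, b ∈ F_q with a ≠ 0 and 4a³ + 27b² ≠ 0 (so y² = x³ + ax + b is an elliptic curve with j-invariant ≠ 0). Suppose k ∈ F_q satisfies 3k² + a = 0, and set d = k³ + ak + b (necessarily d ≠ 0). Let N = #{(x, y) ∈ F_q × F_q : y² = x³ + ax + b}. Then, as an identity in ℂ, q − N = −φ(d) − (φ(d)/(q−1)) · Σ_{l=0}^{q−2} (G_{−2l} · G_{−2l} · G_{3l} / G_{−l}) · T^l(4d/(27k³)). (This is the Gauss-sum form of Theorem 1.3: the left-hand side q − N is the trace of Frobenius a_q(E_{a,b}).) -/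

import Mathlib

open Finset

section Aux
variable {F : Type} [Field F] [Fintype F] [DecidableEq F]

noncomputable def qc (F : Type) [Field F] [Fintype F] [DecidableEq F] : MulChar F ℂ :=
  (quadraticChar F).ringHomComp (Int.castRingHom ℂ)

lemma qc_apply (x : F) : qc F x = ((quadraticChar F x : ℤ) : ℂ) := rfl

@[simp] lemma qc_zero : qc F 0 = 0 := MulChar.map_zero _

lemma qc_sq {x : F} (hx : x ≠ 0) : qc F (x ^ 2) = 1 := by
  rw [qc_apply, quadraticChar_sq_one' hx]; simp

lemma qc_mul_self : qc F * qc F = 1 := by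
  apply MulChar.ext
  intro u
  rw [MulChar.mul_apply, ← map_mul, ← pow_two, qc_sq u.ne_zero, MulChar.one_apply_coe]

lemma qc_ne_one (hF : ringChar F ≠ 2) : qc F ≠ 1 := by
  rw [qc, MulChar.ringHomComp_ne_one_iff (RingHom.injective_int _)]
  exact quadraticChar_ne_one hF

lemma qc_sqrts (hF : ringChar F ≠ 2) (x : F) :
    ((univ.filter fun y : F => y ^ 2 = x).card : ℂ) = qc F x + 1 := by
  have h := quadraticChar_card_sqrts hF x
  rw [qc_apply]
  have h2 : {y : F | y ^ 2 = x}.toFinset = univ.filter fun y : F => y ^ 2 = x := by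
    ext; simp
  rw [h2] at h
  exact_mod_cast h

lemma qc_unique {χ : MulChar F ℂ} (h2 : χ * χ = 1) (h1 : χ ≠ 1) : χ = qc F := by
  have hsq : ∀ x : F, x ≠ 0 → IsSquare x → χ x = 1 := by
    rintro x hx ⟨y, rfl⟩
    have hy : y ≠ 0 := by rintro rfl; simp at hx
    rw [map_mul, ← MulChar.mul_apply, h2, MulChar.one_apply hy.isUnit]
  apply MulChar.ext
  intro u
  have hu := u.ne_zero
  by_cases hs : IsSquare (u : F)
  · rw [hsq _ hu hs, qc_apply, (quadraticChar_one_iff_isSquare hu).2 hs]; simp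
  · have hq : quadraticChar F (u : F) = -1 := quadraticChar_neg_one_iff_not_isSquare.2 hs
    rw [qc_apply, hq]
    have : χ u * χ u = 1 := by rw [← MulChar.mul_apply, h2, MulChar.one_apply_coe]
    rcases mul_self_eq_one_iff.1 this with h | h
    · exfalso
      apply h1
      apply MulChar.ext
      intro v
      rw [MulChar.one_apply_coe]
      by_cases hv : IsSquare (v : F)
      · exact hsq _ v.ne_zero hv
      · have hqv : quadraticChar F (v : F) = -1 := quadraticChar_neg_one_iff_not_isSquare.2 hv
        have : χ (u * v) = 1 := by
          apply hsq _ (mul_ne_zero hu v.ne_zero)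
          rw [← quadraticChar_one_iff_isSquare (mul_ne_zero hu v.ne_zero), map_mul, hq, hqv]
          norm_num
        rwa [map_mul, h, one_mul] at this
    · rw [h]; simp

lemma sum_sq (hF : ringChar F ≠ 2) (f : F → ℂ) :
    ∑ z : F, f (z ^ 2) = ∑ y : F, f y * (qc F y + 1) := by
  rw [← Finset.sum_fiberwise (s := univ) (g := fun z : F => z ^ 2)]
  refine sum_congr rfl fun y _ => ?_
  rw [← qc_sqrts hF, Finset.sum_congr rfl (g := fun _ => f y), sum_const, nsmul_eq_mul, mul_comm]
  intro z hz
  rw [(mem_filter.1 hz).2]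

lemma two_ne' (hF : ringChar F ≠ 2) : (2 : F) ≠ 0 := Ring.two_ne_zero hF

lemma jac (hF : ringChar F ≠ 2) {χ : MulChar F ℂ} (h1 : χ ≠ 1) :
    χ 4 * jacobiSum χ χ = jacobiSum χ (qc F) := by
  have h2 := two_ne' hF
  have e : jacobiSum χ (qc F) = ∑ z : F, χ (1 - z ^ 2) := by
    rw [jacobiSum_comm, jacobiSum, sum_sq hF (fun y => χ (1 - y))]
    simp only [mul_add, mul_one, sum_add_distrib]
    have : ∑ x : F, χ (1 - x) = 0 := by
      rw [← MulChar.sum_eq_zero_of_ne_one h1]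
      exact (Equiv.subLeft (1 : F)).sum_comp (fun x => χ x)
    rw [this, add_zero]
    exact sum_congr rfl fun _ _ => mul_comm _ _
  rw [e, ← ((Equiv.mulLeft₀ (2 : F) h2).trans (Equiv.subLeft 1)).sum_comp, jacobiSum, mul_sum]
  refine sum_congr rfl fun x _ => ?_
  rw [← map_mul, ← map_mul]
  congr 1
  simp
  ring

lemma gauss_ne {θ : AddChar F ℂ} (hθ : θ ≠ 1) (χ : MulChar F ℂ) : gaussSum χ θ ≠ 0 := by
  by_cases h : χ = 1
  · rw [h, gaussSum_one_left hθ]; norm_num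
  · exact gaussSum_ne_zero_of_nontrivial (by simp) h (AddChar.IsPrimitive.of_ne_one hθ)

lemma hd (hF : ringChar F ≠ 2) {θ : AddChar F ℂ} (hθ : θ ≠ 1) (χ : MulChar F ℂ) :
    gaussSum χ θ * gaussSum (χ * qc F) θ * χ 4 = gaussSum (χ * χ) θ * gaussSum (qc F) θ := by
  have h2 := two_ne' hF
  have h4 : (4 : F) = 2 ^ 2 := by norm_num
  by_cases h : χ * χ = 1
  · by_cases h1 : χ = 1
    · subst h1
      rw [h4, MulChar.one_apply (pow_ne_zero 2 h2).isUnit]; simp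
    · rw [qc_unique h h1, qc_mul_self, h4, qc_sq h2]; ring
  · have h1 : χ ≠ 1 := by rintro rfl; simp at h
    have h3 : χ * qc F ≠ 1 := by
      intro h'
      apply h
      have : χ = qc F := by
        rw [← mul_one χ, ← qc_mul_self, ← mul_assoc, h', one_mul]
      rw [this, qc_mul_self]
    have a := jacobiSum_mul_nontrivial h θ
    have b := jacobiSum_mul_nontrivial h3 θ
    have c := jac hF h1
    have n := gauss_ne hθ χ
    rw [← c] at b
    have : gaussSum χ θ * (gaussSum χ θ * gaussSum (χ * qc F) θ * χ 4)
      = gaussSum χ θ * (gaussSum (χ * χ) θ * gaussSum (qc F) θ) := by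
      linear_combination (-gaussSum (χ * qc F) θ * χ 4) * a + gaussSum (χ * χ) θ * b
    exact mul_left_cancel₀ n this

lemma T_order {T : MulChar F ℂ} (hT : ∀ χ : MulChar F ℂ, ∃ n : ℤ, χ = T ^ n) :
    orderOf T = Fintype.card F - 1 := by
  rw [orderOf_eq_card_of_forall_mem_zpowers, MulChar.card_eq_card_units_of_hasEnoughRootsOfUnity,
    Nat.card_eq_fintype_card, Fintype.card_units]
  intro χ
  obtain ⟨n, rfl⟩ := hT χ
  exact ⟨n, rfl⟩

lemma orth {T : MulChar F ℂ} (hT : ∀ χ : MulChar F ℂ, ∃ n : ℤ, χ = T ^ n) (x : F) :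
    ∑ l ∈ range (Fintype.card F - 1), (T ^ l) x =
      if x = 1 then (Fintype.card F : ℂ) - 1 else 0 := by
  have hc : 1 ≤ Fintype.card F := Fintype.card_pos
  split_ifs with h
  · subst h; simp [Nat.cast_sub hc]
  · by_cases h0 : x = 0
    · subst h0
      exact sum_eq_zero fun l _ => MulChar.map_zero _
    lift x to Fˣ using (isUnit_iff_ne_zero.2 h0)
    simp only [MulChar.pow_apply_coe]
    have hne : T x ≠ 1 := by
      intro h1
      obtain ⟨χ, hχ⟩ := MulChar.exists_apply_ne_one_of_hasEnoughRootsOfUnity F ℂ h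
      apply hχ
      obtain ⟨n, rfl⟩ := hT χ
      obtain ⟨m, rfl | rfl⟩ := n.eq_nat_or_neg
      · rw [zpow_natCast, MulChar.pow_apply_coe, h1, one_pow]
      · rw [zpow_neg, zpow_natCast, MulChar.inv_apply_eq_inv', MulChar.pow_apply_coe, h1]; simp
    rw [geom_sum_eq hne, ← MulChar.pow_apply_coe, ← T_order hT, pow_orderOf_eq_one]
    simp

lemma phi_eq {T : MulChar F ℂ} (hT : ∀ χ : MulChar F ℂ, ∃ n : ℤ, χ = T ^ n)
    (hF : ringChar F ≠ 2) : T ^ ((Fintype.card F - 1) / 2) = qc F := by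
  have ho := T_order hT
  have hodd := FiniteField.odd_card_of_char_ne_two hF
  have hc : 1 < Fintype.card F := Fintype.one_lt_card
  apply qc_unique
  · rw [← pow_add, ← orderOf_dvd_iff_pow_eq_one, ho]
    apply dvd_of_eq
    omega
  · rw [Ne, ← orderOf_dvd_iff_pow_eq_one, ho]
    intro h
    have := Nat.le_of_dvd (by omega) h
    omega

lemma shift (hF : ringChar F ≠ 2) (θ : AddChar F ℂ) (t : F) :
    ∑ w : F, qc F w * θ (w * t) = gaussSum (qc F) θ * qc F t := by
  by_cases h : t = 0
  · subst h; simp [MulChar.sum_eq_zero_of_ne_one (qc_ne_one hF)]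
  · rw [gaussSum, sum_mul, ← Equiv.sum_comp (Equiv.mulRight₀ t h) (fun i => qc F i * θ i * qc F t)]
    refine sum_congr rfl fun w _ => ?_
    have := qc_sq h
    rw [pow_two, map_mul] at this
    simp only [Equiv.mulRight₀_apply, map_mul]
    linear_combination (- qc F w * θ (w * t)) * this

lemma triple {T : MulChar F ℂ} (hT : ∀ χ : MulChar F ℂ, ∃ n : ℤ, χ = T ^ n)
    (hF : ringChar F ≠ 2) (θ : AddChar F ℂ) (c : F) (hc : c ≠ 0) :
    ∑ l ∈ range (Fintype.card F - 1),
      gaussSum ((T ^ l)⁻¹ ^ 2) θ * gaussSum ((T ^ l) ^ 3) θ * gaussSum ((T ^ l)⁻¹ * qc F) θ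
        * (T ^ l) c =
    ((Fintype.card F : ℂ) - 1) * (gaussSum (qc F) θ *
      ∑ s : F, qc F (c / s ^ 2) * qc F (1 + s + c / s ^ 2)) := by
  have e1 : ∀ l, gaussSum ((T ^ l)⁻¹ ^ 2) θ * gaussSum ((T ^ l) ^ 3) θ *
      gaussSum ((T ^ l)⁻¹ * qc F) θ * (T ^ l) c =
      ∑ u : F, ∑ w : F, ∑ v : F,
        (qc F v * θ (u + w + v)) * (T ^ l) (w ^ 3 * c / (u ^ 2 * v)) := by
    intro l
    simp only [gaussSum, sum_mul_sum]
    simp only [sum_mul, mul_sum]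
    refine sum_congr rfl fun u _ => ?_
    rw [sum_comm]
    refine sum_congr rfl fun w _ => sum_congr rfl fun v _ => ?_
    rw [MulChar.pow_apply' _ two_ne_zero, MulChar.pow_apply' _ three_ne_zero, MulChar.mul_apply,
      MulChar.inv_apply', MulChar.inv_apply', AddChar.map_add_eq_mul, AddChar.map_add_eq_mul,
      div_eq_mul_inv, mul_inv, ← inv_pow]
    simp only [map_mul, map_pow]
    ring
  have e2 : ∀ u w : F, ∑ v : F, (qc F v * θ (u + w + v)) *
      (if w ^ 3 * c / (u ^ 2 * v) = 1 then (Fintype.card F : ℂ) - 1 else 0) =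
      ((Fintype.card F : ℂ) - 1) * (qc F (w ^ 3 * c / u ^ 2) * θ (u + w + w ^ 3 * c / u ^ 2)) := by
    intro u w
    rw [Finset.sum_eq_single (w ^ 3 * c / u ^ 2)]
    · by_cases hu : u = 0
      · subst hu; simp
      by_cases hw : w = 0
      · subst hw; simp
      rw [if_pos]
      · ring
      · field_simp
    · intro v _ hv
      rw [if_neg, mul_zero]
      intro h
      apply hv
      have hne : u ^ 2 * v ≠ 0 := by
        intro h0; rw [h0, div_zero] at h; exact zero_ne_one h
      have hu : u ^ 2 ≠ 0 := left_ne_zero_of_mul hne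
      rw [div_eq_one_iff_eq hne] at h
      rw [h, mul_div_cancel_left₀ _ hu]
    · simp
  have e3 : ∀ w : F, ∑ u : F, qc F (w ^ 3 * c / u ^ 2) * θ (u + w + w ^ 3 * c / u ^ 2) =
      ∑ s : F, qc F (c / s ^ 2) * (qc F w * θ (w * (1 + s + c / s ^ 2))) := by
    intro w
    by_cases hw : w = 0
    · subst hw; simp
    · rw [← Equiv.sum_comp (Equiv.mulRight₀ w hw)]
      refine sum_congr rfl fun s _ => ?_
      simp only [Equiv.mulRight₀_apply]
      by_cases hs : s = 0
      · subst hs; simp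
      have : w ^ 3 * c / (s * w) ^ 2 = c / s ^ 2 * w := by field_simp
      rw [this, map_mul, mul_assoc]
      congr 3
      ring
  rw [sum_congr rfl fun l _ => e1 l, sum_comm]
  rw [mul_sum (a := gaussSum (qc F) θ)]
  calc _ = ∑ u : F, ∑ w : F, ((Fintype.card F : ℂ) - 1) *
            (qc F (w ^ 3 * c / u ^ 2) * θ (u + w + w ^ 3 * c / u ^ 2)) := by
        refine sum_congr rfl fun u _ => ?_
        rw [sum_comm]
        refine sum_congr rfl fun w _ => ?_
        rw [sum_comm, ← e2]
        refine sum_congr rfl fun v _ => ?_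
        rw [← mul_sum, orth hT]
    _ = ((Fintype.card F : ℂ) - 1) * ∑ w : F, ∑ s : F,
          qc F (c / s ^ 2) * (qc F w * θ (w * (1 + s + c / s ^ 2))) := by
        rw [sum_comm, mul_sum]
        refine sum_congr rfl fun w _ => ?_
        rw [← mul_sum, e3]
    _ = _ := by
        rw [sum_comm]
        congr 1
        refine sum_congr rfl fun s _ => ?_
        rw [← mul_sum, shift hF]
        ring

end Aux

/-- Gauss-sum form of Theorem 1.3: for the elliptic curve `y² = x³ + ax + b` with `j ≠ 0`
and `3k² + a = 0`, setting `d = k³ + ak + b`,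
`q - N = -φ(d) - (φ(d)/(q-1)) Σ_l (G_{-2l}G_{-2l}G_{3l}/G_{-l}) T^l(4d/(27k³))`. -/
theorem trace_frobenius_gauss_sum_form_thm1
    {p r : ℕ} (hp : p.Prime) (hp3 : 3 < p) (hr : 0 < r)
    {F : Type} [Field F] [Fintype F] [DecidableEq F]
    (hcard : Fintype.card F = p ^ r)
    (T : MulChar F ℂ) (hT : ∀ χ : MulChar F ℂ, ∃ n : ℤ, χ = T ^ n)
    (θ : AddChar F ℂ) (hθ : θ ≠ 1)
    (G : ℤ → ℂ) (hG : ∀ m : ℤ, G m = gaussSum (T ^ m) θ)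
    (φ : MulChar F ℂ) (hφ : φ = T ^ (((p ^ r - 1) / 2 : ℕ) : ℤ))
    (a b : F) (ha : a ≠ 0) (hΔ : 4 * a ^ 3 + 27 * b ^ 2 ≠ 0)
    (k : F) (hk : 3 * k ^ 2 + a = 0)
    (d : F) (hd : d = k ^ 3 + a * k + b)
    (N : ℕ)
    (hN : N = Fintype.card {xy : F × F // xy.2 ^ 2 = xy.1 ^ 3 + a * xy.1 + b}) :
    (p ^ r : ℂ) - (N : ℂ) =
      -φ d - φ d / ((p ^ r : ℂ) - 1) *
        ∑ l ∈ range (p ^ r - 1),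
          G (-2 * (l : ℤ)) * G (-2 * (l : ℤ)) * G (3 * (l : ℤ)) / G (-(l : ℤ)) *
            (T ^ (l : ℤ)) (4 * d / (27 * k ^ 3)) := by
  have : Fact p.Prime := ⟨hp⟩
  have : CharP F p := charP_of_card_eq_prime_pow hcard
  have hrc : ringChar F = p := ringChar.eq F p
  have hF : ringChar F ≠ 2 := by omega
  have h2 : (2 : F) ≠ 0 := two_ne' hF
  have h3 : (3 : F) ≠ 0 := by
    intro h
    have h' : ((3 : ℕ) : F) = 0 := by exact_mod_cast h
    rw [CharP.cast_eq_zero_iff F p] at h'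
    have := Nat.le_of_dvd (by norm_num) h'
    omega
  have hφ' : φ = qc F := by
    rw [hφ, zpow_natCast, ← hcard, phi_eq hT hF]
  have ha' : a = -(3 * k ^ 2) := by linear_combination hk
  have hk0 : k ≠ 0 := by
    rintro rfl; apply ha; rw [ha']; ring
  have hd0 : d ≠ 0 := by
    intro h0
    apply hΔ
    have hb : b = 2 * k ^ 3 := by rw [h0, ha'] at hd; linear_combination -hd
    rw [hb, ha']; ring
  have hq1 : (Fintype.card F : ℂ) - 1 ≠ 0 := by
    have : 1 < Fintype.card F := Fintype.one_lt_card
    have h : (Fintype.card F : ℂ) ≠ 1 := by exact_mod_cast this.ne'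
    exact sub_ne_zero.2 h
  have hpr : (p ^ r : ℂ) = (Fintype.card F : ℂ) := by rw [hcard]; push_cast; rfl
  have hNsum : (N : ℂ) = (Fintype.card F : ℂ) + ∑ x : F, qc F (x ^ 3 + a * x + b) := by
    have : N = ∑ x : F, (univ.filter fun y : F => y ^ 2 = x ^ 3 + a * x + b).card := by
      rw [hN, Fintype.card_subtype, ← univ_product_univ, card_filter, sum_product]
      simp only [card_filter]
    rw [this]
    push_cast
    rw [sum_congr rfl fun x _ => qc_sqrts hF (x ^ 3 + a * x + b), sum_add_distrib]
    simp [add_comm]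
  have hNs : ∑ x : F, qc F (x ^ 3 + a * x + b) = ∑ x : F, qc F (x ^ 3 + 3 * k * x ^ 2 + d) := by
    rw [← Equiv.sum_comp (Equiv.addRight k)]
    refine sum_congr rfl fun x _ => ?_
    congr 1
    simp only [Equiv.coe_addRight]
    rw [hd, ha']; ring
  have hgq := gauss_ne hθ (qc F)
  set c : F := d / (27 * k ^ 3) with hc
  have h27 : (27 : F) = 3 ^ 3 := by norm_num
  have h27' : (27 : F) ≠ 0 := by rw [h27]; exact pow_ne_zero 3 h3
  have h4' : (4 : F) ≠ 0 := by rw [show (4 : F) = 2 ^ 2 by norm_num]; exact pow_ne_zero 2 h2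
  have hc0 : c ≠ 0 := div_ne_zero hd0 (mul_ne_zero h27' (pow_ne_zero 3 hk0))
  have key : (∑ l ∈ range (p ^ r - 1),
          G (-2 * (l : ℤ)) * G (-2 * (l : ℤ)) * G (3 * (l : ℤ)) / G (-(l : ℤ)) *
            (T ^ (l : ℤ)) (4 * d / (27 * k ^ 3))) =
      ((Fintype.card F : ℂ) - 1) *
        ∑ s : F, qc F (c / s ^ 2) * qc F (1 + s + c / s ^ 2) := by
    have t := triple hT hF θ c hc0
    apply mul_left_cancel₀ hgq
    rw [mul_left_comm, ← t, mul_sum, ← hcard]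
    refine sum_congr rfl fun l _ => ?_
    have g2 : G (-2 * (l : ℤ)) = gaussSum ((T ^ l)⁻¹ ^ 2) θ := by
      rw [hG]; congr 1
      rw [← zpow_natCast T l, ← zpow_neg, ← zpow_natCast, ← zpow_mul]; congr 1; push_cast; ring
    have g3 : G (3 * (l : ℤ)) = gaussSum ((T ^ l) ^ 3) θ := by
      rw [hG]; congr 1
      rw [← zpow_natCast T l, ← zpow_natCast, ← zpow_mul]; congr 1; push_cast; ring
    have g1 : G (-(l : ℤ)) = gaussSum ((T ^ l)⁻¹) θ := by
      rw [hG, zpow_neg, zpow_natCast]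
    rw [g2, g3, g1, zpow_natCast]
    have H := _root_.hd hF hθ (T ^ l)⁻¹
    have n := gauss_ne hθ (T ^ l)⁻¹
    rw [← pow_two] at H
    have h4 : (T ^ l)⁻¹ 4 * (T ^ l) 4 = 1 := by
      rw [← MulChar.mul_apply, inv_mul_cancel, MulChar.one_apply h4'.isUnit]
    have e : 4 * d / (27 * k ^ 3) = 4 * c := by rw [hc]; ring
    rw [e, map_mul]
    field_simp
    linear_combination (-gaussSum ((T ^ l)⁻¹ ^ 2) θ * gaussSum ((T ^ l) ^ 3) θ * (T ^ l) 4 * (T ^ l) c) * H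
      + (gaussSum ((T ^ l)⁻¹ ^ 2) θ * gaussSum ((T ^ l) ^ 3) θ * (T ^ l) c * gaussSum (T ^ l)⁻¹ θ
        * gaussSum ((T ^ l)⁻¹ * qc F) θ) * h4
  have dd : qc F d * qc F d = 1 := by rw [← map_mul, ← pow_two, qc_sq hd0]
  have key2 : ∑ x : F, qc F (x ^ 3 + 3 * k * x ^ 2 + d) =
      qc F d + qc F d * ∑ s : F, qc F (c / s ^ 2) * qc F (1 + s + c / s ^ 2) := by
    have h3k : 3 * k ≠ 0 := mul_ne_zero h3 hk0
    rw [← Equiv.sum_comp (Equiv.mulLeft₀ (3 * k) h3k), mul_sum,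
      ← Finset.add_sum_erase _ _ (mem_univ (0 : F)),
      ← Finset.add_sum_erase univ (fun s : F => qc F d * (qc F (c / s ^ 2) * qc F (1 + s + c / s ^ 2))) (mem_univ (0 : F))]
    simp only [Equiv.mulLeft₀_apply]
    congr 1
    · simp
    · have z : qc F d * (qc F (c / 0 ^ 2) * qc F (1 + 0 + c / 0 ^ 2)) = 0 := by simp
      rw [z, zero_add]
      refine sum_congr rfl fun s hs => ?_
      have hs0 : s ≠ 0 := ne_of_mem_erase hs
      rw [← map_mul, ← map_mul]
      have : d * (c / s ^ 2 * (1 + s + c / s ^ 2)) =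
        (d / (27 * k ^ 3 * s ^ 2)) ^ 2 * ((3 * k * s) ^ 3 + 3 * k * (3 * k * s) ^ 2 + d) := by
        rw [hc]; field_simp; ring
      rw [this, map_mul, qc_sq, one_mul]
      exact div_ne_zero hd0 (mul_ne_zero (mul_ne_zero h27' (pow_ne_zero 3 hk0)) (pow_ne_zero 2 hs0))
  rw [key, hpr, hNsum, hNs, key2, hφ']
  field_simp
  ring
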